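/- arXiv:2406.20049 — 3 statements merged into one kernel-verified Lean document; each statement's English description precedes it below -/
import Mathlib

section
/- For the original Litt game with A = HH and B = HT, for every n ≥ 3 the number of words X ∈ {H,T}^n with N_B(X) > N_A(X) is strictly greater than the number with N_A(X) > N_B(X); i.e., Bob is strictly more likely to win than Alice. -/
/-- Number of (possibly overlapping) occurrences of `A` as a contiguous
substring of `X`, counted via start positions. -/
def countOcc (A X : List Bool) : ℕ :=
  ((Finset.range (X.length + 1)).filter
    (fun i => i + A.length ≤ X.length ∧ (X.drop i).take A.length = A)).card

/-- Correlation set `Cor(A,B)`: those `1 ≤ k ≤ ℓ-1` such that the length-`k`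
suffix of `A` equals the length-`k` prefix of `B`. -/
def corSet (A B : List Bool) : Finset ℕ :=
  (Finset.Icc 1 (A.length - 1)).filter (fun k => A.drop (A.length - k) = B.take k)

/-- Correlation number `[A,B] = Σ_{k ∈ Cor(A,B)} 2^k`. -/
def corNum (A B : List Bool) : ℕ := ∑ k ∈ corSet A B, 2 ^ k

/-- The swap: `bar A B A = B`, `bar A B B = A` (when `C ∈ {A,B}`). -/
def bar (A B C : List Bool) : List Bool := if C = A then B else A

/-- The word `C₁ ^{m₁} C₂ ^{m₂} ⋯ ^{m_{k-1}} C_k`. -/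
def chainWord : List (List Bool) → List ℕ → List Bool
  | [], _ => []
  | [C], _ => C
  | C :: C' :: Cs, m :: ms => C ++ (chainWord (C' :: Cs) ms).drop m
  | C :: _ :: _, [] => C

/-- Validity of the chain data: each `mᵢ ∈ Cor(Cᵢ, Cᵢ₊₁)`. -/
def chainValid (Cs : List (List Bool)) (ms : List ℕ) : Prop :=
  ∀ i, i < ms.length → ms.getD i 0 ∈ corSet (Cs.getD i []) (Cs.getD (i + 1) [])

/-- `Y` is an overlap of `A` and `B`, i.e. `Y = C₁ ^{m₁} ⋯ ^{m_{k-1}} C_k`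
with all `Cᵢ ∈ {A,B}` and `mᵢ ∈ Cor(Cᵢ,Cᵢ₊₁)`. -/
def isOverlap (A B Y : List Bool) : Prop :=
  ∃ Cs ms, Cs ≠ [] ∧ Cs.length = ms.length + 1 ∧ (∀ C ∈ Cs, C = A ∨ C = B) ∧
    chainValid Cs ms ∧ Y = chainWord Cs ms

/-- `Y'` is obtained from the overlap `Y = C₁ ^{m₁} ⋯ ^{m_{k-1}} C_k` by the
swap map: `Y' = C̄_k ^{m_{k-1}} ⋯ ^{m₁} C̄₁` (for some decomposition of `Y`). -/
def overlapFlip (A B Y Y' : List Bool) : Prop :=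
  ∃ Cs ms, Cs ≠ [] ∧ Cs.length = ms.length + 1 ∧ (∀ C ∈ Cs, C = A ∨ C = B) ∧
    chainValid Cs ms ∧ Y = chainWord Cs ms ∧
    Y' = chainWord ((Cs.map (bar A B)).reverse) ms.reverse

/-- `interleave [X₀,…,X_k] [E₁,…,E_k] = X₀ E₁ X₁ ⋯ E_k X_k`. -/
def interleave : List (List Bool) → List (List Bool) → List Bool
  | [], _ => []
  | X :: _, [] => X
  | X :: Xs, E :: Es => X ++ E ++ interleave Xs Es

/-- `Y = X₀ E₁ X₁ ⋯ E_k X_k` is a decomposition of `Y` with respect to `(A,B)`: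
the `Eᵢ` are overlaps of `A` and `B` capturing all occurrences of `A` and `B`
in `Y`, and the gaps `Xᵢ` contain no occurrence of `A` or `B`. -/
def isDecomp (A B Y : List Bool) (Xs Es : List (List Bool)) : Prop :=
  Xs.length = Es.length + 1 ∧ Y = interleave Xs Es ∧
  (∀ E ∈ Es, isOverlap A B E) ∧
  (∀ X ∈ Xs, countOcc A X = 0 ∧ countOcc B X = 0) ∧
  countOcc A Y = (Es.map (countOcc A)).sum ∧
  countOcc B Y = (Es.map (countOcc B)).sum

/-- `L^M(I)`: the number of words `Y` with pattern `M = (E₁,…,E_k)` and gap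
lengths `I = (i₀,…,i_k)`. -/
noncomputable def patCount (A B : List Bool) (M : List (List Bool)) (I : List ℕ) : ℕ :=
  {Y : List Bool | ∃ Xs, isDecomp A B Y Xs M ∧ Xs.map List.length = I}.ncard

/-- `M'` is the image of the pattern `M = (E₁,…,E_k)` under
`φ(E₁,…,E_k) = (φ(E_k),…,φ(E₁))`. -/
def patternFlip (A B : List Bool) (M M' : List (List Bool)) : Prop :=
  M'.length = M.length ∧
  ∀ j, j < M.length → overlapFlip A B (M.reverse.getD j []) (M'.getD j [])

namespace LittAux
open PowerSeries

/-- geometric series `1/(1-x)` -/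
noncomputable def I : PowerSeries ℤ := PowerSeries.mk 1
/-- geometric series `1/(1-2x)` -/
noncomputable def J : PowerSeries ℤ := PowerSeries.mk (fun n => 2 ^ n)

lemma I_eq : I = 1 + X * I := by
  ext n
  cases n with
  | zero => simp [I]
  | succ n => simp [I, coeff_succ_X_mul, coeff_one]

lemma J_eq : J = 1 + X * (2 * J) := by
  ext n
  cases n with
  | zero => simp [J]
  | succ n => rw [two_mul]; simp [J, coeff_succ_X_mul, coeff_one, pow_succ, mul_two]

lemma exists_c : ∃ c : PowerSeries ℤ, c = 1 + X ^ 3 * I * c ^ 2 := by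
  have hs : HasSubst (X ^ 3 * I : PowerSeries ℤ) :=
    HasSubst.of_constantCoeff_zero' (by simp)
  let z : PowerSeries ℤ := (catalanSeries).map (Nat.castRingHom ℤ)
  have hz : z = 1 + X * z ^ 2 := by
    have := congrArg (PowerSeries.map (Nat.castRingHom ℤ)) catalanSeries_sq_mul_X_add_one
    simp only [map_add, map_mul, map_pow, map_one, PowerSeries.map_X] at this
    rw [show X * z ^ 2 = z ^ 2 * X by ring, add_comm]
    exact this.symm
  refine ⟨substAlgHom hs z, ?_⟩
  conv_lhs => rw [hz]
  rw [map_add, map_mul, map_pow, map_one]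
  congr 2
  rw [coe_substAlgHom, subst_X hs]

noncomputable def c : PowerSeries ℤ := exists_c.choose
lemma c_eq : c = 1 + X ^ 3 * I * c ^ 2 := exists_c.choose_spec

noncomputable def M : PowerSeries ℤ := X * c
noncomputable def N : PowerSeries ℤ := X ^ 2 * I * c
noncomputable def V : PowerSeries ℤ := X * I * c

lemma exists_R : ∃ R : PowerSeries ℤ, R = 1 + X * (2 * N * R) := by
  refine ⟨invOfUnit (1 - 2 * X * N) 1, ?_⟩
  have := mul_invOfUnit (1 - 2 * X * N) 1 (by simp)
  linear_combination this

noncomputable def R : PowerSeries ℤ := exists_R.choose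
lemma R_eq : R = 1 + X * (2 * N * R) := exists_R.choose_spec

noncomputable def G : ℤ → PowerSeries ℤ
  | Int.ofNat j => J * (1 - M ^ j) + M ^ j * (N * R)
  | Int.negSucc j => - J * (1 - N ^ (j + 1)) + N ^ (j + 1) * (N * R) + N ^ j * V

noncomputable def Wt (k : ℤ) : PowerSeries ℤ := I * (C k.sign + X * G k)

lemma Wt_eq (k : ℤ) : Wt k = C k.sign + X * (G k + Wt k) := by
  unfold Wt
  linear_combination (C k.sign + X * G k) * I_eq

lemma IJ : I + X * I * J = J := by
  have h1 : (1 - X) * (I + X * I * J - J) = 0 := by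
    linear_combination (1 + X * J) * I_eq - J_eq
  have h2 : I * (1 - X) = 1 := by linear_combination I_eq
  linear_combination I * h1 - (I + X * I * J - J) * h2

lemma M_eq : M = X + X * (X * I) * M ^ 2 := by
  unfold M; linear_combination X * c_eq
lemma N_eq : N = X * (X * I) + X * N ^ 2 := by
  unfold N; linear_combination X ^ 2 * I * c_eq
lemma V_eq : V = X * I + X * N * V := by
  unfold V N; linear_combination X * I * c_eq
lemma N_M : N = X * I * M := by unfold N M; ring
lemma N_V : N = X * V := by unfold N V; ring

lemma G_eq (k : ℤ) : G k = C k.sign + X * (G (k - 1) + Wt (k + 1)) := by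
  match k with
  | Int.ofNat 0 =>
    have e1 : (Int.ofNat 0 - 1 : ℤ) = Int.negSucc 0 := rfl
    have e2 : (Int.ofNat 0 + 1 : ℤ) = Int.ofNat 1 := rfl
    rw [e1, e2]
    have s0 : (Int.ofNat 0).sign = 0 := rfl
    have s1 : (Int.ofNat 1).sign = 1 := rfl
    simp only [Wt, G, s0, s1, map_zero, map_one]
    linear_combination N * R_eq - X * IJ + N_V + (X * N * R - X * J) * N_M
  | Int.ofNat (j + 1) =>
    have e1 : (Int.ofNat (j + 1) - 1 : ℤ) = Int.ofNat j := by simp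
    have e2 : (Int.ofNat (j + 1) + 1 : ℤ) = Int.ofNat (j + 2) := rfl
    rw [e1, e2]
    have s0 : (Int.ofNat (j + 1)).sign = 1 := rfl
    have s1 : (Int.ofNat (j + 2)).sign = 1 := rfl
    simp only [Wt, G, s0, s1, map_one]
    linear_combination J_eq - X * IJ + (N * R - J) * M ^ j * M_eq
  | Int.negSucc 0 =>
    have e1 : (Int.negSucc 0 - 1 : ℤ) = Int.negSucc 1 := rfl
    have e2 : (Int.negSucc 0 + 1 : ℤ) = Int.ofNat 0 := rfl
    rw [e1, e2]
    have s0 : (Int.negSucc 0).sign = -1 := rfl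
    have s1 : (Int.ofNat 0).sign = 0 := rfl
    simp only [Wt, G, s0, s1, map_zero, map_neg, map_one]
    linear_combination -J_eq + X * IJ + (N * R + J) * N_eq + V_eq
  | Int.negSucc (j + 1) =>
    have e1 : (Int.negSucc (j + 1) - 1 : ℤ) = Int.negSucc (j + 2) := rfl
    have e2 : (Int.negSucc (j + 1) + 1 : ℤ) = Int.negSucc j := rfl
    rw [e1, e2]
    have s0 : (Int.negSucc (j + 1)).sign = -1 := rfl
    have s1 : (Int.negSucc j).sign = -1 := rfl
    simp only [Wt, G, s0, s1, map_neg, map_one]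
    linear_combination -J_eq + X * IJ + (N * R + J) * N ^ (j + 1) * N_eq + N ^ j * V * N_eq

/-- Sum of the signs of the final scores. -/
def S : ℕ → Bool → ℤ → ℤ
  | 0, _, k => k.sign
  | r + 1, true, k => S r true (k - 1) + S r false (k + 1)
  | r + 1, false, k => S r true k + S r false k

lemma S_eq (r : ℕ) : ∀ k, S r true k = coeff r (G k) ∧ S r false k = coeff r (Wt k) := by
  induction r with
  | zero =>
    intro k
    constructor
    · rw [G_eq, map_add, coeff_zero_X_mul, coeff_C]
      simp [S]
    · rw [Wt_eq, map_add, coeff_zero_X_mul, coeff_C]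
      simp [S]
  | succ r ih =>
    intro k
    constructor
    · rw [G_eq, map_add, coeff_succ_X_mul, coeff_C, S, (ih _).1, (ih _).2, map_add]
      simp
    · rw [Wt_eq, map_add, coeff_succ_X_mul, coeff_C, S, (ih _).1, (ih _).2, map_add]
      simp

def Nn (n : ℕ) (F : PowerSeries ℤ) : Prop := ∀ i < n, 0 ≤ coeff i F

lemma Nn.mul {n F F'} (h : Nn n F) (h' : Nn n F') : Nn n (F * F') := by
  intro i hi
  rw [coeff_mul]
  refine Finset.sum_nonneg fun p hp => ?_
  have := Finset.HasAntidiagonal.mem_antidiagonal.1 hp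
  exact mul_nonneg (h _ (by omega)) (h' _ (by omega))
lemma Nn.add {n F F'} (h : Nn n F) (h' : Nn n F') : Nn n (F + F') := by
  intro i hi
  rw [map_add]
  exact add_nonneg (h i hi) (h' i hi)
lemma Nn.X_mul {n F} (h : Nn n F) : Nn (n + 1) (X * F) := by
  intro i hi
  cases i with
  | zero => simp
  | succ i => rw [coeff_succ_X_mul]; exact h i (by omega)
lemma Nn.mono {n m F} (h : Nn n F) (hm : m ≤ n) : Nn m F := fun i hi => h i (by omega)
lemma Nn_one (n) : Nn n 1 := by
  intro i _
  rw [coeff_one]; split_ifs <;> simp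
lemma Nn_I (n) : Nn n I := by
  intro i _
  simp [I]
lemma Nn_X (n) : Nn n (X : PowerSeries ℤ) := by
  intro i _
  rw [coeff_X]; split_ifs <;> simp
lemma Nn_c (n) : Nn n c := by
  induction n with
  | zero => intro i hi; omega
  | succ n ih =>
    rw [c_eq, show 1 + X ^ 3 * I * c ^ 2 = 1 + X * (X * X * I * (c * c)) by ring]
    exact (Nn_one _).add ((((Nn_X n).mul (Nn_X n)).mul (Nn_I n)).mul (ih.mul ih)).X_mul
lemma Nn_N (n) : Nn n N := by
  rw [show N = X * X * I * c by unfold N; ring]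
  exact (((Nn_X n).mul (Nn_X n)).mul (Nn_I n)).mul (Nn_c n)
lemma Nn_R (n) : Nn n R := by
  induction n with
  | zero => intro i hi; omega
  | succ n ih =>
    rw [R_eq, show 2 * N * R = (N + N) * R by ring]
    exact (Nn_one _).add (((Nn_N n).add (Nn_N n)).mul ih).X_mul

lemma S_pos (n : ℕ) (hn : 3 ≤ n) : 0 < S n false 0 := by
  obtain ⟨m, rfl⟩ := Nat.exists_eq_add_of_le hn
  rw [(S_eq _ 0).2]
  have h0 : Wt 0 = X ^ 3 * (I + I * (X * I * (c * R) +
      (X * (X * X * I * (c * c)) * R + X * ((N + N) * R)))) := by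
    have : G 0 = N * R := by
      change J * (1 - M ^ 0) + M ^ 0 * (N * R) = _
      ring
    rw [Wt, this]
    simp only [Int.sign_zero, map_zero]
    rw [show I * (0 + X * (N * R)) = X ^ 3 * (I * (I * (c * R))) by unfold N; ring]
    congr 1
    linear_combination I * c * R * I_eq + I * R * c_eq + I * R_eq
  rw [h0, show 3 + m = m + 3 by omega, coeff_X_pow_mul, map_add]
  have h1 : coeff m I = 1 := by simp [I]
  have hX := Nn_X (m + 1)
  have hI := Nn_I (m + 1)
  have hc := Nn_c (m + 1)
  have hR := Nn_R (m + 1)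
  have hN := Nn_N (m + 1)
  have := (hI.mul (((hX.mul hI).mul (hc.mul hR)).add
    (((hX.mul (((hX.mul hX).mul hI).mul (hc.mul hc))).mul hR).add
      (hX.mul ((hN.add hN).mul hR))))) m (by omega)
  omega

/-- score of a word given the preceding letter -/
def sc : Bool → List Bool → ℤ
  | _, [] => 0
  | true, true :: l => -1 + sc true l
  | true, false :: l => 1 + sc false l
  | false, x :: l => sc x l

lemma countOcc_cons (a b x : Bool) (l : List Bool) :
    countOcc [a, b] (x :: l) = (if (x :: l).take 2 = [a, b] then 1 else 0) + countOcc [a, b] l := by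
  unfold countOcc
  rw [Finset.card_filter, Finset.card_filter, List.length_cons, Finset.sum_range_succ', add_comm]
  congr 1
  · cases l <;> simp
  · refine Finset.sum_congr rfl fun i _ => ?_
    simp only [List.drop_succ_cons, List.length_cons]
    congr 1
    simp

lemma countOcc_nil (a b : Bool) : countOcc [a, b] [] = 0 := by
  simp [countOcc]

lemma sc_aux (l : List Bool) : ∀ p : Bool,
    (countOcc [true, false] (p :: l) : ℤ) - countOcc [true, true] (p :: l) = sc p l := by
  induction l with
  | nil => intro p; simp [countOcc_cons, countOcc_nil, sc]
  | cons x l ih =>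
    intro p
    have := ih x
    rw [countOcc_cons, countOcc_cons true true p]
    cases p <;> cases x <;> simp [sc] <;> omega

lemma sc_eq (l : List Bool) :
    (countOcc [true, false] l : ℤ) - countOcc [true, true] l = sc false l := by
  rw [← sc_aux, countOcc_cons, countOcc_cons true true false]
  simp

def consEmb (x : Bool) : List Bool ↪ List Bool := ⟨fun l => x :: l, fun _ _ h => by simpa using h⟩
lemma consEmb_apply (x : Bool) (l : List Bool) : consEmb x l = x :: l := rfl

def words : ℕ → Finset (List Bool)
  | 0 => {[]}
  | n + 1 => (words n).map (consEmb true) ∪ (words n).map (consEmb false)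

lemma mem_words (n : ℕ) : ∀ l, l ∈ words n ↔ l.length = n := by
  induction n with
  | zero => intro l; simp [words]
  | succ n ih =>
    intro l
    rcases l with _ | ⟨x, l⟩
    · simp [words, consEmb_apply]
    · cases x <;> simp [words, consEmb_apply, ih]

lemma sum_words (n : ℕ) : ∀ p k, ∑ l ∈ words n, (k + sc p l).sign = S n p k := by
  induction n with
  | zero => intro p k; simp [words, sc, S]
  | succ n ih =>
    intro p k
    rw [words, Finset.sum_union, Finset.sum_map, Finset.sum_map]
    · cases p
      · simp [consEmb_apply, sc, S, ih]
      · simp [consEmb_apply, sc, S, ← ih, ← add_assoc, sub_eq_add_neg]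
    · rw [Finset.disjoint_left]
      intro l
      simp only [Finset.mem_map, consEmb_apply]
      rintro ⟨a, _, rfl⟩ ⟨b, _, h⟩
      simp at h

end LittAux

/-- for `A = HH`, `B = HT` (`H = true`, `T = false`) and every
`n ≥ 3`, strictly more words of length `n` have `N_B > N_A` than `N_A > N_B`:
Bob is strictly more likely to win than Alice. -/
theorem original_litt_bob_wins (n : ℕ) (hn : 3 ≤ n) :
    {X : List Bool | X.length = n ∧
        countOcc [true, false] X > countOcc [true, true] X}.ncard >
    {X : List Bool | X.length = n ∧
        countOcc [true, true] X > countOcc [true, false] X}.ncard := by 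
  have key := LittAux.S_pos n hn
  rw [← LittAux.sum_words] at key
  have h1 : {X : List Bool | X.length = n ∧
        countOcc [true, false] X > countOcc [true, true] X} =
      ((LittAux.words n).filter (fun X => countOcc [true, false] X > countOcc [true, true] X) :
        Finset (List Bool)) := by
    ext X; simp [LittAux.mem_words]
  have h2 : {X : List Bool | X.length = n ∧
        countOcc [true, true] X > countOcc [true, false] X} =
      ((LittAux.words n).filter (fun X => countOcc [true, true] X > countOcc [true, false] X) :
        Finset (List Bool)) := by
    ext X; simp [LittAux.mem_words]
  rw [h1, h2, Set.ncard_coe_finset, Set.ncard_coe_finset, Finset.card_filter, Finset.card_filter]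
  zify
  rw [← sub_pos, ← Finset.sum_sub_distrib]
  refine lt_of_lt_of_eq key (Finset.sum_congr rfl fun X _ => ?_)
  rw [zero_add, ← LittAux.sc_eq]
  rcases lt_trichotomy (countOcc [true, false] X) (countOcc [true, true] X) with h | h | h
  · rw [Int.sign_eq_neg_one_of_neg (by omega), if_neg (by omega), if_pos (by omega)]
    rfl
  · rw [h]; simp
  · rw [Int.sign_eq_one_of_pos (by omega), if_pos (by omega), if_neg (by omega)]
    rfl
end

section
/- Handicapped Litt game: with A = HH and B = HT, for every n ≥ 0 the number of words X ∈ {H,T}^n satisfying N_A(X) + 1 > N_B(X) is strictly greater than 2^{n−1}; i.e., giving Alice one extra point makes her winning probability strictly exceed 1/2 (for n ≥ 1). -/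
/-- Words of length `n` (stored reversed). -/
def hlW : ℕ → Finset (List Bool)
  | 0 => {[]}
  | n + 1 => (hlW n).image (List.cons true) ∪ (hlW n).image (List.cons false)

/-- Number of occurrences of `H c` in the reversed word. -/
def hlP (c : Bool) : List Bool → ℕ
  | [] => 0
  | b :: L => hlP c L + if L.head? = some true ∧ b = c then 1 else 0

theorem hlW_mem (n : ℕ) : ∀ L : List Bool, L ∈ hlW n ↔ L.length = n := by
  induction n with
  | zero => intro L; simp [hlW]
  | succ n ih =>
    intro L
    cases L with
    | nil => simp [hlW]
    | cons b L => cases b <;> simp [hlW, ih]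

theorem hlW_sum (n : ℕ) (f : List Bool → ℕ) :
    ∑ L ∈ hlW (n + 1), f L = ∑ L ∈ hlW n, f (true :: L) + ∑ L ∈ hlW n, f (false :: L) := by
  rw [hlW, Finset.sum_union, Finset.sum_image, Finset.sum_image]
  · intro a _ b _ h; simpa using h
  · intro a _ b _ h; simpa using h
  · rw [Finset.disjoint_left]
    intro a h1 h2
    simp only [Finset.mem_image] at h1 h2
    obtain ⟨x, _, rfl⟩ := h1
    obtain ⟨y, _, h⟩ := h2
    simp at h

theorem hl_countOcc_concat (c b : Bool) (X : List Bool) :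
    countOcc [true, c] (X ++ [b]) =
      countOcc [true, c] X + if X.getLast? = some true ∧ b = c then 1 else 0 := by
  have key : ∀ Y : List Bool, countOcc [true, c] Y =
      ∑ i ∈ Finset.range (Y.length - 1),
        if Y[i]? = some true ∧ Y[i + 1]? = some c then 1 else 0 := by
    intro Y
    rw [countOcc, ← Finset.card_filter]
    congr 1
    ext i
    simp only [Finset.mem_filter, Finset.mem_range, List.length_cons, List.length_nil]
    constructor
    · rintro ⟨h1, h2, h3⟩
      refine ⟨by omega, ?_⟩
      have e0 := congrArg (fun l : List Bool => l[0]?) h3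
      have e1 := congrArg (fun l : List Bool => l[1]?) h3
      simpa [List.getElem?_take, List.getElem?_drop] using And.intro e0 e1
    · rintro ⟨h1, h2, h3⟩
      refine ⟨by omega, by omega, ?_⟩
      apply List.ext_getElem?
      intro k
      rcases k with _ | _ | k
      · simpa [List.getElem?_take, List.getElem?_drop] using h2
      · simpa [List.getElem?_take, List.getElem?_drop] using h3
      · simp [List.getElem?_take]
  rw [key, key]
  rcases Nat.eq_zero_or_pos X.length with h0 | h0
  · have : X = [] := List.length_eq_zero_iff.mp h0
    subst this; simp
  · obtain ⟨m, hm⟩ : ∃ m, X.length = m + 1 := ⟨X.length - 1, by omega⟩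
    have hl : (X ++ [b]).length - 1 = m + 1 := by simp [hm]
    rw [hl, hm, Finset.sum_range_succ]
    congr 1
    · apply Finset.sum_congr (by simp)
      intro i hi
      have hi' : i < m := by simpa using hi
      rw [List.getElem?_append_left (by omega), List.getElem?_append_left (by omega)]
    · rw [List.getElem?_append_left (by omega), List.getElem?_append_right (by omega),
        List.getLast?_eq_getElem?, hm]
      simp

theorem hl_countOcc_reverse (c : Bool) (L : List Bool) :
    countOcc [true, c] L.reverse = hlP c L := by
  induction L with
  | nil => simp [hlP, countOcc]
  | cons b L ih => rw [List.reverse_cons, hl_countOcc_concat, ih, hlP, List.getLast?_reverse]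

/-- words ending in H with given counts -/
def hlH (n x y : ℕ) : ℕ := ∑ L ∈ hlW n,
  if L.head? = some true ∧ hlP true L = x ∧ hlP false L = y then 1 else 0

/-- words not ending in H with given counts -/
def hlT (n x y : ℕ) : ℕ := ∑ L ∈ hlW n,
  if L.head? ≠ some true ∧ hlP true L = x ∧ hlP false L = y then 1 else 0

theorem hlH_succ (n x y : ℕ) : hlH (n + 1) (x + 1) y = hlH n x y + hlT n (x + 1) y := by
  simp only [hlH, hlT, hlW_sum, ← Finset.sum_add_distrib]
  apply Finset.sum_congr rfl
  intro L _
  by_cases h : L.head? = some true <;> simp [hlP, h]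

theorem hlH_zero (n y : ℕ) : hlH (n + 1) 0 y = hlT n 0 y := by
  simp only [hlH, hlT, hlW_sum, ← Finset.sum_add_distrib]
  apply Finset.sum_congr rfl
  intro L _
  by_cases h : L.head? = some true <;> simp [hlP, h]

theorem hlT_succ (n x y : ℕ) : hlT (n + 1) x (y + 1) = hlT n x (y + 1) + hlH n x y := by
  simp only [hlH, hlT, hlW_sum, ← Finset.sum_add_distrib]
  apply Finset.sum_congr rfl
  intro L _
  by_cases h : L.head? = some true <;> simp [hlP, h]

theorem hlT_zero (n x : ℕ) : hlT (n + 1) x 0 = hlT n x 0 := by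
  simp only [hlT, hlW_sum, ← Finset.sum_add_distrib]
  apply Finset.sum_congr rfl
  intro L _
  by_cases h : L.head? = some true <;> simp [hlP, h]

theorem hl_closed (n : ℕ) :
    (∀ x, hlH n x 0 = if x < n then 1 else 0) ∧
    (∀ x y, hlH n x (y + 1) = (x + y + 1).choose (y + 1) * (n - 2 - x - y).choose (y + 1)) ∧
    (∀ x, hlT n x 0 = if x = 0 then 1 else 0) ∧
    (∀ x y, hlT n x (y + 1) = (x + y).choose y * (n - x - y - 1).choose (y + 1)) := by
  induction n with
  | zero =>
    refine ⟨?_, ?_, ?_, ?_⟩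
    · intro x; simp [hlH, hlW]
    · intro x y; simp [hlH, hlW]
    · intro x; rw [hlT, hlW, Finset.sum_singleton]; simp [hlP, eq_comm]
    · intro x y; simp [hlT, hlW, hlP]
  | succ n ih =>
    obtain ⟨h0, h1, t0, t1⟩ := ih
    refine ⟨?_, ?_, ?_, ?_⟩
    · intro x
      cases x with
      | zero => rw [hlH_zero, t0]; simp
      | succ x => rw [hlH_succ, t0, h0]; simp
    · intro x y
      cases x with
      | zero =>
        rw [hlH_zero, t1]
        have : n + 1 - 2 - 0 - y = n - 0 - y - 1 := by omega
        rw [this]; simp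
      | succ x =>
        rw [hlH_succ, t1, h1]
        have e2 : n + 1 - 2 - (x + 1) - y = n - (x + 1) - y - 1 := by omega
        have e3 : n - 2 - x - y = n - (x + 1) - y - 1 := by omega
        rw [e2, e3, Nat.choose_succ_succ (x + 1 + y) y,
          show x + 1 + y = x + y + 1 by omega]
        ring
    · intro x; rw [hlT_zero, t0]
    · intro x y
      cases y with
      | zero =>
        rw [hlT_succ, t1, h0]
        simp
        split_ifs <;> omega
      | succ y =>
        rw [hlT_succ, t1, h1]
        by_cases hn : x + y + 2 ≤ n
        · obtain ⟨k, rfl⟩ := Nat.exists_eq_add_of_le hn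
          have e1 : x + y + 2 + k + 1 - x - (y + 1) - 1 = k + 1 := by omega
          have e2 : x + y + 2 + k - x - (y + 1) - 1 = k := by omega
          have e3 : x + y + 2 + k - 2 - x - y = k := by omega
          rw [e1, e2, e3, Nat.choose_succ_succ k (y + 1), ← add_assoc x y 1]
          ring
        · have e1 : n + 1 - x - (y + 1) - 1 = 0 := by omega
          have e2 : n - x - (y + 1) - 1 = 0 := by omega
          have e3 : n - 2 - x - y = 0 := by omega
          rw [e1, e2, e3]; simp

theorem hl_key (n s : ℕ) : hlT n (s + 1) (s + 1) = hlH n s (s + 1) := by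
  obtain ⟨-, h1, -, t1⟩ := hl_closed n
  rw [h1, t1]
  have e : n - (s + 1) - s - 1 = n - 2 - s - s := by omega
  rw [e, show s + 1 + s = s + s + 1 by omega]
  congr 1
  rw [← two_mul]
  exact (Nat.choose_symm_half s).symm

theorem hlP_le (c : Bool) (L : List Bool) : hlP c L ≤ L.length := by
  induction L with
  | nil => simp [hlP]
  | cons b L ih => simp only [hlP, List.length_cons]; split_ifs <;> omega

theorem hl_bij (n : ℕ) :
    (∑ L ∈ hlW n, if L.head? ≠ some true ∧ hlP true L = hlP false L then 1 else 0) =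
    1 + ∑ L ∈ hlW n, if L.head? = some true ∧ hlP true L + 1 = hlP false L then 1 else 0 := by
  have hT : (∑ L ∈ hlW n, if L.head? ≠ some true ∧ hlP true L = hlP false L then 1 else 0) =
      ∑ s ∈ Finset.range (n + 1), hlT n s s := by
    simp only [hlT]
    rw [Finset.sum_comm]
    apply Finset.sum_congr rfl
    intro L hL
    have hle := hlP_le true L
    rw [(hlW_mem n L).1 hL] at hle
    rw [Finset.sum_eq_single (hlP true L)]
    · simp [eq_comm]
    · intro s _ hs
      rw [if_neg]; rintro ⟨_, h, _⟩; exact hs h.symm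
    · intro h; simp at h; omega
  have hH : (∑ L ∈ hlW n, if L.head? = some true ∧ hlP true L + 1 = hlP false L then 1 else 0) =
      ∑ s ∈ Finset.range n, hlH n s (s + 1) := by
    simp only [hlH]
    rw [Finset.sum_comm]
    apply Finset.sum_congr rfl
    intro L hL
    have hle := hlP_le false L
    rw [(hlW_mem n L).1 hL] at hle
    by_cases hc : L.head? = some true ∧ hlP true L + 1 = hlP false L
    · rw [if_pos hc, Finset.sum_eq_single (hlP true L)]
      · rw [if_pos ⟨hc.1, rfl, hc.2.symm⟩]
      · intro s _ hs
        rw [if_neg]; rintro ⟨_, h, _⟩; exact hs h.symm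
      · intro h; simp at h; omega
    · rw [if_neg hc, Finset.sum_eq_zero]
      intro s _
      rw [if_neg]; rintro ⟨h1, h2, h3⟩; exact hc ⟨h1, by omega⟩
  rw [hT, hH, Finset.sum_range_succ', (hl_closed n).2.2.1]
  simp only [hl_key]
  simp [add_comm]

theorem hl_main (n : ℕ) :
    2 * (∑ L ∈ hlW n, if hlP false L ≤ hlP true L then 1 else 0) =
    2 ^ n + 1 +
      ∑ L ∈ hlW n, if L.head? = some true ∧ hlP true L = hlP false L then 1 else 0 := by
  induction n with
  | zero => rw [hlW, Finset.sum_singleton, Finset.sum_singleton]; simp [hlP]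
  | succ n ih =>
    have hb := hl_bij n
    have e1 : (∑ L ∈ hlW (n + 1), if hlP false L ≤ hlP true L then 1 else 0) +
        (∑ L ∈ hlW n, if L.head? = some true ∧ hlP true L = hlP false L then 1 else 0) =
        2 * (∑ L ∈ hlW n, if hlP false L ≤ hlP true L then 1 else 0) +
        ∑ L ∈ hlW n, if L.head? = some true ∧ hlP true L + 1 = hlP false L then 1 else 0 := by
      rw [hlW_sum, two_mul]
      simp only [← Finset.sum_add_distrib]
      apply Finset.sum_congr rfl
      intro L _
      by_cases h : L.head? = some true <;> simp [hlP, h] <;> split_ifs <;> omega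
    have e2 : (∑ L ∈ hlW (n + 1),
          if L.head? = some true ∧ hlP true L = hlP false L then 1 else 0) =
        (∑ L ∈ hlW n, if L.head? = some true ∧ hlP true L + 1 = hlP false L then 1 else 0) +
        ∑ L ∈ hlW n, if L.head? ≠ some true ∧ hlP true L = hlP false L then 1 else 0 := by
      rw [hlW_sum]
      simp only [← Finset.sum_add_distrib]
      apply Finset.sum_congr rfl
      intro L _
      by_cases h : L.head? = some true <;> simp [hlP, h]
    rw [e2, pow_succ]
    omega

/-- handicapped Litt game with `A = HH`, `B = HT`: for every
`n ≥ 0`, the number of words `X` of length `n` with `N_{HH}(X) + 1 > N_{HT}(X)`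
is strictly greater than `2^{n-1}`, i.e. strictly more than half of the `2^n`
words: `2 · #{X : N_{HH}(X) + 1 > N_{HT}(X)} > 2^n`. -/
theorem handicapped_litt (n : ℕ) :
    2 * {X : List Bool | X.length = n ∧
        countOcc [true, true] X + 1 > countOcc [true, false] X}.ncard > 2 ^ n := by
  have hset : {X : List Bool | X.length = n ∧
        countOcc [true, true] X + 1 > countOcc [true, false] X} =
      Set.image List.reverse (((hlW n).filter (fun L => hlP false L ≤ hlP true L) :
        Finset (List Bool)) : Set (List Bool)) := by
    ext X
    simp only [Set.mem_setOf_eq, Set.mem_image, Finset.coe_filter, hlW_mem]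
    constructor
    · rintro ⟨h1, h2⟩
      refine ⟨X.reverse, ⟨by simpa using h1, ?_⟩, by simp⟩
      rw [← hl_countOcc_reverse, ← hl_countOcc_reverse, List.reverse_reverse]
      omega
    · rintro ⟨L, ⟨h1, h2⟩, rfl⟩
      rw [hl_countOcc_reverse, hl_countOcc_reverse]
      exact ⟨by simpa using h1, by omega⟩
  rw [hset, Set.ncard_image_of_injective _ List.reverse_injective, Set.ncard_coe_finset,
    Finset.card_filter, hl_main]
  omega
end

section
/- Gap-count symmetry lemma: let A, B be words of length ℓ with Cor(A,A) = Cor(B,B), and let φ act on overlaps by reversing the chain and swapping A ↔ B, extended to patterns by φ(E_1,…,E_k) = (φ(E_k),…,φ(E_1)). Then for every pattern M = (E_1,…,E_k) and every tuple of gap lengths I = (i_0,…,i_k), L^{M}(I) = L^{φ(M)}(I'), where I' = (i_k,…,i_0) is the reversed tuple. -/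
/-- `W` occurs in `Y` at position `p`. -/
def occ (W Y : List Bool) (p : ℕ) : Prop :=
  p + W.length ≤ Y.length ∧ ∀ j, j < W.length → Y.getD (p + j) false = W.getD j false

/-- the two words, indexed by a label -/
def wd (A B : List Bool) (a : Bool) : List Bool := if a = true then A else B

lemma list_ext_getD {X Y : List Bool} (h : X.length = Y.length)
    (h2 : ∀ i, i < X.length → X.getD i false = Y.getD i false) : X = Y := by
  apply List.ext_getElem h
  intro i h1 h3
  have := h2 i h1
  rwa [List.getD_eq_getElem _ _ h1, List.getD_eq_getElem _ _ h3] at this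

lemma getD_take_lt (X : List Bool) (n i : ℕ) (h : i < n) :
    (X.take n).getD i false = X.getD i false := by
  simp [List.getD_eq_getElem?_getD, List.getElem?_take, h]

lemma getD_drop' (X : List Bool) (n i : ℕ) :
    (X.drop n).getD i false = X.getD (n + i) false := by
  simp [List.getD_eq_getElem?_getD, List.getElem?_drop]

lemma getD_app_l (X Y : List Bool) (i : ℕ) (h : i < X.length) :
    (X ++ Y).getD i false = X.getD i false := by
  simp [List.getD_eq_getElem?_getD, List.getElem?_append, h]

lemma getD_app_r (X Y : List Bool) (i : ℕ) (h : X.length ≤ i) :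
    (X ++ Y).getD i false = Y.getD (i - X.length) false := by
  simp [List.getD_eq_getElem?_getD, List.getElem?_append, Nat.not_lt.mpr h]

lemma occ_iff (W Y : List Bool) (p : ℕ) :
    occ W Y p ↔ p + W.length ≤ Y.length ∧ (Y.drop p).take W.length = W := by
  unfold occ
  constructor
  · rintro ⟨h1, h2⟩
    refine ⟨h1, list_ext_getD (by simp; omega) ?_⟩
    intro i hi
    have hi' : i < W.length := by simp at hi; omega
    rw [getD_take_lt _ _ _ hi', getD_drop', h2 i hi']
  · rintro ⟨h1, h2⟩
    refine ⟨h1, ?_⟩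
    intro j hj
    conv_rhs => rw [← h2]
    rw [getD_take_lt _ _ _ hj, getD_drop']

lemma occ_trans {W E Y : List Bool} {p s : ℕ} (h1 : occ W E p) (h2 : occ E Y s) :
    occ W Y (s + p) := by
  refine ⟨by have := h1.1; have := h2.1; omega, ?_⟩
  intro j hj
  rw [add_assoc, h2.2 _ (by have := h1.1; omega), h1.2 _ hj]

lemma occ_app_l {W E : List Bool} {p : ℕ} (F : List Bool) (h1 : occ W E p) :
    occ W (E ++ F) p := by
  refine ⟨by have := h1.1; simp; omega, ?_⟩
  intro j hj
  rw [getD_app_l _ _ _ (by have := h1.1; omega), h1.2 _ hj]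

lemma occ_app_r {W E : List Bool} {p : ℕ} (F : List Bool) (h1 : occ W E p) :
    occ W (F ++ E) (F.length + p) := by
  refine ⟨by have := h1.1; simp; omega, ?_⟩
  intro j hj
  rw [getD_app_r _ _ _ (by omega), ← h1.2 _ hj]
  congr 1; omega

lemma occ_self (W : List Bool) : occ W W 0 := ⟨by simp, by simp⟩

open Classical in
lemma countOcc_eq (W Y : List Bool) :
    countOcc W Y = ((Finset.range (Y.length + 1)).filter (fun i => occ W Y i)).card := by
  unfold countOcc
  congr 1
  ext i
  simp only [Finset.mem_filter, occ_iff]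

lemma countOcc_zero (W Y : List Bool) : countOcc W Y = 0 ↔ ∀ p, ¬ occ W Y p := by
  classical
  rw [countOcc_eq, Finset.card_eq_zero, Finset.filter_eq_empty_iff]
  constructor
  · intro h p hp
    exact h (Finset.mem_range.2 (by have := hp.1; omega)) hp
  · intro h p _; exact h p

lemma mem_cor {ℓ : ℕ} {X Y : List Bool} (hX : X.length = ℓ) (hY : Y.length = ℓ) (m : ℕ) :
    m ∈ corSet X Y ↔ 1 ≤ m ∧ m < ℓ ∧ ∀ i, i < m → X.getD (ℓ - m + i) false = Y.getD i false := by
  unfold corSet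
  simp only [Finset.mem_filter, Finset.mem_Icc, hX]
  constructor
  · rintro ⟨⟨h1, h2⟩, h3⟩
    refine ⟨h1, by omega, ?_⟩
    intro i hi
    rw [← getD_drop', h3, getD_take_lt _ _ _ hi]
  · rintro ⟨h1, h2, h3⟩
    refine ⟨⟨h1, by omega⟩, list_ext_getD (by simp; omega) ?_⟩
    intro i hi
    have hi' : i < m := by simp at hi; omega
    rw [getD_drop', getD_take_lt _ _ _ hi', h3 i hi']

/-- hypotheses bundle -/
structure Good (ℓ : ℕ) (A B : List Bool) : Prop where
  hA : A.length = ℓ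
  hB : B.length = ℓ
  hcor : corSet A A = corSet B B
  pos : 0 < ℓ

section

variable {ℓ : ℕ} {A B : List Bool}

lemma Good.len (g : Good ℓ A B) (a : Bool) : (wd A B a).length = ℓ := by
  cases a <;> simp [wd, g.hA, g.hB]

lemma Good.cor (g : Good ℓ A B) (a : Bool) :
    corSet (wd A B a) (wd A B a) = corSet (wd A B !a) (wd A B !a) := by
  cases a <;> simp [wd, g.hcor]

lemma Good.cor_flip (g : Good ℓ A B) (a b : Bool) :
    corSet (wd A B a) (wd A B b) = corSet (wd A B !b) (wd A B !a) := by
  cases a <;> cases b <;> simp [wd, g.hcor]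

/-- value of letter -/
def vl (A B : List Bool) (a : Bool) (i : ℕ) : Bool := (wd A B a).getD i false

/-- pairwise compatibility -/
def compat (ℓ : ℕ) (A B : List Bool) (p : ℕ) (a : Bool) (q : ℕ) (b : Bool) : Prop :=
  ∀ x, p ≤ x → x < p + ℓ → q ≤ x → x < q + ℓ → vl A B a (x - p) = vl A B b (x - q)

lemma compat.symm {p q : ℕ} {a b : Bool} (h : compat ℓ A B p a q b) : compat ℓ A B q b p a :=
  fun x h1 h2 h3 h4 => (h x h3 h4 h1 h2).symm

lemma compat_same_flip_lt (g : Good ℓ A B) {p q p' q' : ℕ} {a : Bool} (hpq : p < q)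
    (e : p + p' = q + q') (h : compat ℓ A B p a q a) : compat ℓ A B p' (!a) q' (!a) := by
  intro x h1 h2 h3 h4
  have hm : ℓ - (q - p) ∈ corSet (wd A B a) (wd A B a) := by
    rw [mem_cor (g.len a) (g.len a)]
    refine ⟨by omega, by omega, ?_⟩
    intro i hi
    have := h (q + i) (by omega) (by omega) (by omega) (by omega)
    unfold vl at this
    convert this using 2 <;> omega
  rw [g.cor, mem_cor (g.len _) (g.len _)] at hm
  have := hm.2.2 (x - p') (by omega)
  unfold vl
  rw [← this]
  congr 1; omega

lemma compat_flip (g : Good ℓ A B) {p q p' q' : ℕ} {a b : Bool}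
    (e : p + p' = q + q') (h : compat ℓ A B p a q b) : compat ℓ A B p' (!a) q' (!b) := by
  by_cases hab : a = b
  · subst hab
    rcases lt_trichotomy p q with hl | hl | hl
    · exact compat_same_flip_lt g hl e h
    · intro x _ _ _ _
      have : p' = q' := by omega
      rw [this]
    · exact (compat_same_flip_lt g hl e.symm h.symm).symm
  · have hb : (!a) = b := by cases a <;> cases b <;> simp_all
    have ha : (!b) = a := by cases a <;> cases b <;> simp_all
    rw [hb, ha]
    intro x h1 h2 h3 h4
    have := h (x - p' + q) (by omega) (by omega) (by omega) (by omega)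
    convert this.symm using 2 <;> omega

lemma occ_compat (g : Good ℓ A B) {Y : List Bool} {p q : ℕ} {a b : Bool}
    (h1 : occ (wd A B a) Y p) (h2 : occ (wd A B b) Y q) : compat ℓ A B p a q b := by
  intro x k1 k2 k3 k4
  unfold vl
  rw [← h1.2 _ (by rw [g.len]; omega), ← h2.2 _ (by rw [g.len]; omega)]
  congr 1; omega

/-- transfer of an occurrence to the flipped word -/
lemma transfer (g : Good ℓ A B) {E E' : List Bool} {L : ℕ} (hE : E.length = L)
    (hE' : E'.length = L) (P : Set (ℕ × Bool))
    (hP : ∀ k ∈ P, k.1 + ℓ ≤ L ∧ occ (wd A B k.2) E k.1 ∧ occ (wd A B !k.2) E' (L - ℓ - k.1))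
    (hc : ∀ x, x < L → ∃ k ∈ P, k.1 ≤ x ∧ x < k.1 + ℓ) (p : ℕ) (a : Bool)
    (h : occ (wd A B a) E p) : occ (wd A B !a) E' (L - ℓ - p) := by
  have hp := h.1
  rw [g.len] at hp
  refine ⟨by rw [g.len]; omega, ?_⟩
  intro j hj
  rw [g.len] at hj
  obtain ⟨⟨q, b⟩, hk, hx1, hx2⟩ := hc (p + ℓ - 1 - j) (by omega)
  obtain ⟨h1, h2, h3⟩ := hP _ hk
  simp only at hx1 hx2 h1 h2 h3
  have hcomp := compat_flip g (p' := L - ℓ - p) (q' := L - ℓ - q) (by omega) (occ_compat g h h2)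
  have := hcomp (L - ℓ - p + j) (by omega) (by omega) (by omega) (by omega)
  have h4 := h3.2 (L - ℓ - p + j - (L - ℓ - q)) (by rw [g.len]; omega)
  unfold vl at this
  rw [← this] at h4
  convert h4 using 2 <;> omega

lemma chainWord_len_ge (C : List Bool) (Cs : List (List Bool)) (ms : List ℕ) :
    C.length ≤ (chainWord (C :: Cs) ms).length := by
  cases Cs <;> cases ms <;> simp [chainWord]

lemma chainWord_append (C : List Bool) (m : ℕ) : ∀ (Cs : List (List Bool)) (ms : List ℕ),
    Cs.length = ms.length + 1 → (∀ D ∈ Cs, D.length = ℓ) → (∀ x ∈ ms, x ≤ ℓ) →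
    chainWord (Cs ++ [C]) (ms ++ [m]) = chainWord Cs ms ++ C.drop m := by
  intro Cs
  induction Cs with
  | nil => intro ms h; simp at h
  | cons D Cs ih =>
    intro ms h hD hm
    cases ms with
    | nil =>
      cases Cs with
      | nil => simp [chainWord]
      | cons => simp at h
    | cons x ms =>
      cases Cs with
      | nil => simp at h
      | cons D' Cs =>
        have := ih ms (by simpa using h) (fun D h => hD D (by simp [h])) (fun D h => hm D (by simp [h]))
        simp only [List.cons_append] at this ⊢
        simp only [chainWord]
        rw [this, List.drop_append_of_le_length, List.append_assoc]
        have h1 := chainWord_len_ge D' Cs ms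
        have h2 := hD D' (by simp)
        have h3 := hm x (by simp)
        omega

lemma label {C : List Bool} (h : C = A ∨ C = B) :
    ∃ c, C = wd A B c ∧ bar A B C = wd A B !c := by
  by_cases hC : C = A
  · exact ⟨true, by simp [wd, hC, bar]⟩
  · exact ⟨false, by simp [wd, hC, bar]; tauto⟩

lemma chain_place (g : Good ℓ A B) : ∀ (Cs : List (List Bool)) (ms : List ℕ),
    Cs.length = ms.length + 1 → (∀ C ∈ Cs, C = A ∨ C = B) → chainValid Cs ms →
    ∃ (P : Set (ℕ × Bool)) (L : ℕ), ℓ ≤ L ∧ (chainWord Cs ms).length = L ∧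
      (chainWord ((Cs.map (bar A B)).reverse) ms.reverse).length = L ∧
      (∀ k ∈ P, k.1 + ℓ ≤ L ∧ occ (wd A B k.2) (chainWord Cs ms) k.1 ∧
        occ (wd A B !k.2) (chainWord ((Cs.map (bar A B)).reverse) ms.reverse) (L - ℓ - k.1)) ∧
      (∀ x, x < L → ∃ k ∈ P, k.1 ≤ x ∧ x < k.1 + ℓ) ∧
      ∃ c, (0, c) ∈ P ∧ Cs.head? = some (wd A B c) := by
  intro Cs
  induction Cs with
  | nil => intro ms h; simp at h
  | cons C Cs ih =>
    intro ms h hC hv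
    obtain ⟨c, hc1, hc2⟩ := label (hC C (by simp))
    cases ms with
    | nil =>
      cases Cs with
      | cons => simp at h
      | nil =>
        refine ⟨{(0, c)}, ℓ, le_rfl, ?_, ?_, ?_, ?_, c, rfl, by simp [hc1]⟩
        · simp [chainWord, hc1, g.len]
        · simp [chainWord, hc2, g.len]
        · rintro k rfl
          refine ⟨by simp, ?_, ?_⟩
          · simp only [chainWord, hc1]; exact occ_self _
          · simp [chainWord, hc2]; exact occ_self _
        · intro x hx; exact ⟨(0, c), rfl, by simp, by simpa using hx⟩
    | cons m ms =>
      cases Cs with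
      | nil => simp at h
      | cons D Cs =>
        have hv' : chainValid (D :: Cs) ms := by
          intro i hi
          have := hv (i + 1) (by simpa using hi)
          simpa using this
        obtain ⟨P, L, hL, h1, h2, h3, h4, d, hd, hdh⟩ :=
          ih ms (by simpa using h) (fun D h => hC D (by simp [h])) hv'
        have hDd : D = wd A B d := by simpa using hdh
        have hm : m ∈ corSet (wd A B c) (wd A B d) := by
          have := hv 0 (by simp)
          simpa [hc1, hDd] using this
        have hm' := hm
        rw [g.cor_flip] at hm'
        rw [mem_cor (g.len _) (g.len _)] at hm hm'
        obtain ⟨m1, m2, m3⟩ := hm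
        obtain ⟨-, -, m3'⟩ := hm'
        have hE : chainWord (C :: D :: Cs) (m :: ms) = C ++ (chainWord (D :: Cs) ms).drop m := rfl
        have hE' : chainWord (((C :: D :: Cs).map (bar A B)).reverse) (m :: ms).reverse =
            chainWord (((D :: Cs).map (bar A B)).reverse) ms.reverse ++ (wd A B !c).drop m := by
          rw [List.map_cons, List.reverse_cons, List.reverse_cons, hc2]
          apply chainWord_append (ℓ := ℓ)
          · simpa using h
          · intro X hX
            rw [List.mem_reverse, List.mem_map] at hX
            obtain ⟨X', hX', rfl⟩ := hX
            obtain ⟨e, he1, he2⟩ := label (hC X' (by simp [hX']))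
            rw [he2, g.len]
          · intro x hx
            rw [List.mem_reverse] at hx
            obtain ⟨i, hi, rfl⟩ := List.mem_iff_getElem.1 hx
            have hvi := hv' i hi
            rw [List.getD_eq_getElem _ _ hi] at hvi
            have hi1 : i < (D :: Cs).length := by simp at h ⊢; omega
            rw [List.getD_eq_getElem _ _ hi1] at hvi
            obtain ⟨e, he1, he2⟩ := label (hC (D :: Cs)[i] (List.mem_cons_of_mem _ (List.getElem_mem hi1)))
            unfold corSet at hvi
            rw [he1, g.len] at hvi
            simp at hvi; omega
        rw [hE, hE']
        generalize chainWord (D :: Cs) ms = E at *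
        generalize chainWord (((D :: Cs).map (bar A B)).reverse) ms.reverse = E' at *
        have hC' : C.length = ℓ := by rw [hc1, g.len]
        have lE : (C ++ E.drop m).length = L + ℓ - m := by simp [hC', h1]; omega
        have lE' : (E' ++ (wd A B !c).drop m).length = L + ℓ - m := by simp [h2, g.len]; omega
        have hd3 := h3 _ hd
        simp only [g.len] at hd3
        obtain ⟨-, hd4, hd5⟩ := hd3
        -- E occurs in C ++ E.drop m at ℓ - m
        have oE : occ E (C ++ E.drop m) (ℓ - m) := by
          refine ⟨by omega, ?_⟩
          intro j hj
          by_cases hjm : j < m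
          · rw [getD_app_l _ _ _ (by omega), hc1, m3 j hjm]
            rw [← hd4.2 j (by rw [g.len]; omega)]
            congr 1; omega
          · rw [getD_app_r _ _ _ (by omega), getD_drop']
            congr 1; omega
        refine ⟨insert (0, c) {k | ∃ k' ∈ P, k = (ℓ - m + k'.1, k'.2)}, L + ℓ - m, by omega, lE, lE',
          ?_, ?_, c, by simp, by simp [hc1]⟩
        · rintro k (rfl | ⟨k', hk', rfl⟩)
          · refine ⟨by simp; omega, ?_, ?_⟩
            · simp only [hc1]; exact occ_app_l _ (occ_self _)
            · simp only
              refine ⟨by rw [g.len, lE']; omega, ?_⟩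
              intro j hj
              rw [g.len] at hj
              by_cases hjm : j < m
              · rw [getD_app_l _ _ _ (by omega), ← m3' j hjm, ← hd5.2 _ (by rw [g.len]; omega)]
                congr 1; omega
              · rw [getD_app_r _ _ _ (by omega), getD_drop']
                congr 1; omega
          · obtain ⟨k1, k2, k3⟩ := h3 _ hk'
            refine ⟨by simp; omega, occ_trans k2 oE, ?_⟩
            simp only
            convert occ_app_l _ k3 using 1
            omega
        · intro x hx
          by_cases hxl : x < ℓ
          · exact ⟨(0, c), by simp, by simp, by simpa using hxl⟩
          · obtain ⟨k, hk, q1, q2⟩ := h4 (x - (ℓ - m)) (by omega)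
            exact ⟨_, Or.inr ⟨k, hk, rfl⟩, by simp; omega, by simp; omega⟩

lemma overlap_cover (g : Good ℓ A B) {E : List Bool} (h : isOverlap A B E) :
    ∀ x, x < E.length → ∃ p a, occ (wd A B a) E p ∧ p ≤ x ∧ x < p + ℓ := by
  obtain ⟨Cs, ms, h1, h2, h3, h4, rfl⟩ := h
  obtain ⟨P, L, -, hL, -, hP, hc, -⟩ := chain_place g Cs ms h2 h3 h4
  intro x hx
  obtain ⟨k, hk, q⟩ := hc x (by omega)
  exact ⟨k.1, k.2, (hP k hk).2.1, q⟩

lemma flip_overlap (g : Good ℓ A B) {E E' : List Bool} (h : overlapFlip A B E E') :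
    isOverlap A B E ∧ isOverlap A B E' ∧ ℓ ≤ E.length ∧ E'.length = E.length ∧
    ∀ p a, p + ℓ ≤ E.length →
      (occ (wd A B a) E p ↔ occ (wd A B !a) E' (E.length - ℓ - p)) := by
  obtain ⟨Cs, ms, h1, h2, h3, h4, e1, e2⟩ := h
  refine ⟨⟨Cs, ms, h1, h2, h3, h4, e1⟩, ⟨_, _, ?_, ?_, ?_, ?_, e2⟩, ?_⟩
  · simpa using h1
  · simpa using h2
  · intro C hC
    rw [List.mem_reverse, List.mem_map] at hC
    obtain ⟨X', hX', rfl⟩ := hC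
    unfold bar; split <;> simp
  · intro i hi
    simp only [List.length_reverse] at hi
    have hv := h4 (ms.length - 1 - i) (by omega)
    have l1 : ms.length - 1 - i < Cs.length := by omega
    have l2 : ms.length - 1 - i + 1 < Cs.length := by omega
    rw [List.getD_eq_getElem _ _ l1, List.getD_eq_getElem _ _ l2,
      List.getD_eq_getElem _ _ (by omega)] at hv
    rw [List.getD_eq_getElem _ _ (by simp; omega), List.getD_eq_getElem _ _ (by simp; omega),
      List.getD_eq_getElem _ _ (by simp; omega)]
    simp only [List.getElem_reverse, List.getElem_map, List.length_map]
    obtain ⟨a, ha1, ha2⟩ := label (h3 _ (List.getElem_mem l1))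
    obtain ⟨b, hb1, hb2⟩ := label (h3 _ (List.getElem_mem l2))
    have e1 : Cs.length - 1 - i = ms.length - 1 - i + 1 := by omega
    have e2 : Cs.length - 1 - (i + 1) = ms.length - 1 - i := by omega
    simp only [e1, e2]
    rw [ha2, hb2, ← g.cor_flip, ← ha1, ← hb1]
    exact hv
  · obtain ⟨P, L, hl, hL, hL', hP, hc, -⟩ := chain_place g Cs ms h2 h3 h4
    rw [← e1] at hL hP
    rw [← e2] at hL' hP
    rw [hL, hL']
    refine ⟨hl, rfl, ?_⟩
    intro p a hp
    constructor
    · exact transfer g hL hL' P hP hc p a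
    · intro h
      have := transfer g hL' hL {k | k.1 + ℓ ≤ L ∧ (L - ℓ - k.1, !k.2) ∈ P} ?_ ?_ _ _ h
      · convert this using 1
        · simp
        · omega
      · rintro k ⟨k1, k2⟩
        obtain ⟨q1, q2, q3⟩ := hP _ k2
        refine ⟨k1, ?_, q2⟩
        simp only [Bool.not_not] at q3
        convert q3 using 1; omega
      · intro x hx
        obtain ⟨k, hk, q1, q2⟩ := hc (L - 1 - x) (by omega)
        have := (hP k hk).1
        refine ⟨(L - ℓ - k.1, !k.2), ⟨by simp; omega, ?_⟩, by simp; omega, by simp; omega⟩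
        convert hk using 1
        ext <;> simp
        omega

open Classical in
lemma incl_excl {W K : Type} [Fintype K] (U : Finset W) (O : W → Finset K) (σ : K ≃ K)
    (h : ∀ S : Finset K, (U.filter (fun w => S ⊆ O w)).card =
      (U.filter (fun w => S.map σ.toEmbedding ⊆ O w)).card) (S : Finset K) :
    (U.filter (fun w => O w = S)).card = (U.filter (fun w => O w = S.map σ.toEmbedding)).card := by
  have key : ∀ S : Finset K, (U.filter (fun w => S ⊆ O w)).card =
      (U.filter (fun w => O w = S)).card +
        ∑ T ∈ Finset.univ.filter (fun T => S ⊂ T), (U.filter (fun w => O w = T)).card := by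
    intro S
    rw [Finset.card_eq_sum_card_fiberwise (f := O) (t := Finset.univ.filter (fun T => S ⊆ T))
      (by intro w hw; simpa using (Finset.mem_filter.1 hw).2)]
    have e : Finset.univ.filter (fun T => S ⊆ T) =
        insert S (Finset.univ.filter (fun T => S ⊂ T)) := by
      ext T
      simp only [Finset.mem_filter, Finset.mem_univ, true_and, Finset.mem_insert]
      rw [← Finset.le_iff_subset, le_iff_eq_or_lt, eq_comm, Finset.lt_iff_ssubset]
    rw [e, Finset.sum_insert (by simp)]
    congr 1
    · congr 1; ext w
      simp only [Finset.mem_filter]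
      constructor
      · rintro ⟨⟨a, b⟩, c⟩; exact ⟨a, c⟩
      · rintro ⟨a, c⟩; exact ⟨⟨a, c ▸ le_rfl⟩, c⟩
    · apply Finset.sum_congr rfl
      intro T hT
      have hT' := (Finset.mem_filter.1 hT).2
      congr 1; ext w
      simp only [Finset.mem_filter]
      constructor
      · rintro ⟨⟨a, b⟩, c⟩; exact ⟨a, c⟩
      · rintro ⟨a, c⟩; exact ⟨⟨a, c ▸ hT'.1⟩, c⟩
  induction hn : (Finset.univ \ S).card using Nat.strong_induction_on generalizing S with
  | _ n ih =>
  have h0 := h S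
  rw [key S, key (S.map σ.toEmbedding)] at h0
  have hs : ∑ T ∈ Finset.univ.filter (fun T => S ⊂ T), (U.filter (fun w => O w = T)).card =
      ∑ T ∈ Finset.univ.filter (fun T => S.map σ.toEmbedding ⊂ T),
        (U.filter (fun w => O w = T)).card := by
    apply Finset.sum_equiv σ.finsetCongr
    · intro T
      simp [Equiv.finsetCongr_apply]
    · intro T hT
      have hT' := (Finset.mem_filter.1 hT).2
      rw [Equiv.finsetCongr_apply]
      refine ih _ ?_ T rfl
      rw [← hn]
      apply Finset.card_lt_card
      rw [Finset.ssubset_iff_subset_ne]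
      refine ⟨Finset.sdiff_subset_sdiff le_rfl hT'.1, ?_⟩
      intro hh
      obtain ⟨x, hx, hx'⟩ := Finset.exists_of_ssubset hT'
      have : x ∈ Finset.univ \ S := by simp [hx']
      rw [← hh] at this
      simp [hx] at this
  omega

/-- the words of length n -/
noncomputable def words (n : ℕ) : Finset (List Bool) := (List.finite_length_eq Bool n).toFinset

lemma mem_words {n : ℕ} {Y : List Bool} : Y ∈ words n ↔ Y.length = n := by
  simp [words]

open Classical in
/-- occurrences -/
noncomputable def Oset (ℓ : ℕ) (A B : List Bool) (n : ℕ) (Y : List Bool) :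
    Finset (Fin (n + 1 - ℓ) × Bool) :=
  Finset.univ.filter (fun k => occ (wd A B k.2) Y k.1)

lemma mem_Oset {n : ℕ} {Y : List Bool} {k : Fin (n + 1 - ℓ) × Bool} :
    k ∈ Oset ℓ A B n Y ↔ occ (wd A B k.2) Y k.1 := by
  simp [Oset]

/-- the flip -/
def flipE (N : ℕ) : Fin N × Bool ≃ Fin N × Bool :=
  Equiv.prodCongr Fin.revPerm Equiv.boolNot

lemma flipE_fst {N : ℕ} (k : Fin N × Bool) : ((flipE N k).1 : ℕ) = N - 1 - k.1 := by
  simp [flipE, Fin.val_rev]; omega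

lemma flipE_snd {N : ℕ} (k : Fin N × Bool) : (flipE N k).2 = !k.2 := by
  simp [flipE]

lemma flipE_flipE {N : ℕ} (k : Fin N × Bool) : flipE N (flipE N k) = k := by
  ext <;> simp [flipE]

lemma getD_range_map (n : ℕ) (f : ℕ → Bool) (x : ℕ) (hx : x < n) :
    ((List.range n).map f).getD x false = f x := by
  simp [List.getD_eq_getElem?_getD, hx]

open Classical in
lemma f_le (g : Good ℓ A B) (n : ℕ) (S : Finset (Fin (n + 1 - ℓ) × Bool)) :
    ((words n).filter (fun w => S ⊆ Oset ℓ A B n w)).card ≤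
      ((words n).filter (fun w => S.map (flipE _).toEmbedding ⊆ Oset ℓ A B n w)).card := by
  rcases Finset.eq_empty_or_nonempty ((words n).filter (fun w => S ⊆ Oset ℓ A B n w)) with h | h
  · rw [h]; simp
  obtain ⟨w0, hw0⟩ := h
  rw [Finset.mem_filter, mem_words] at hw0
  obtain ⟨hl0, hS0⟩ := hw0
  have hocc : ∀ {w : List Bool}, S ⊆ Oset ℓ A B n w → ∀ k ∈ S, occ (wd A B k.2) w k.1 :=
    fun h k hk => mem_Oset.1 (h hk)
  have hcomp : ∀ k ∈ S, ∀ k' ∈ S, compat ℓ A B (flipE _ k).1 (flipE _ k).2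
      (flipE _ k').1 (flipE _ k').2 := by
    intro k hk k' hk'
    rw [flipE_snd, flipE_snd]
    refine compat_flip g ?_ (occ_compat g (hocc hS0 k hk) (hocc hS0 k' hk'))
    rw [flipE_fst, flipE_fst]
    have := k.1.2
    have := k'.1.2
    omega
  -- a word realizing the flipped set
  obtain ⟨w1, hw1⟩ : ∃ w1 : ℕ → Bool, ∀ k ∈ S, ∀ j, j < ℓ →
      w1 ((flipE _ k).1 + j) = vl A B (flipE _ k).2 j := by
    refine ⟨fun x => if h : ∃ k ∈ S, ((flipE _ k).1 : ℕ) ≤ x ∧ x < (flipE _ k).1 + ℓ then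
      vl A B (flipE _ h.choose).2 (x - (flipE _ h.choose).1) else false, ?_⟩
    intro k hk j hj
    have h : ∃ k' ∈ S, ((flipE _ k').1 : ℕ) ≤ (flipE _ k).1 + j ∧
      (flipE _ k).1 + j < (flipE _ k').1 + ℓ := ⟨k, hk, by omega, by omega⟩
    simp only [dif_pos h]
    obtain ⟨h1, h2, h3⟩ := h.choose_spec
    rw [hcomp _ h1 _ hk ((flipE _ k).1 + j) h2 h3 (by omega) (by omega)]
    congr 1; omega
  apply Finset.card_le_card_of_injOn
    (fun w => (List.range n).map (fun x => xor (xor (w.getD (n - 1 - x) false)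
      (w0.getD (n - 1 - x) false)) (w1 x)))
  · intro w hw
    have hw' := Finset.mem_filter.1 hw
    rw [mem_words] at hw'
    rw [Finset.mem_coe, Finset.mem_filter, mem_words]
    refine ⟨by simp, ?_⟩
    intro k' hk'
    rw [Finset.mem_map] at hk'
    obtain ⟨k, hk, rfl⟩ := hk'
    rw [mem_Oset]
    simp only [Equiv.coe_toEmbedding]
    have hb := (flipE _ k).1.2
    refine ⟨by rw [g.len]; simp; omega, ?_⟩
    intro j hj
    rw [g.len] at hj
    rw [getD_range_map _ _ _ (by omega), hw1 k hk j hj]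
    have e1 := (hocc hS0 k hk).2 (ℓ - 1 - j) (by rw [g.len]; omega)
    have e2 := (hocc hw'.2 k hk).2 (ℓ - 1 - j) (by rw [g.len]; omega)
    have e3 : n - 1 - ((flipE _ k).1 + j) = k.1 + (ℓ - 1 - j) := by
      have := k.1.2
      rw [flipE_fst]; omega
    rw [e3, e1, e2]
    simp [vl]
  · intro w hw w' hw' heq
    have h1 := (Finset.mem_filter.1 hw).1
    have h2 := (Finset.mem_filter.1 hw').1
    rw [mem_words] at h1 h2
    apply list_ext_getD (by omega)
    intro i hi
    have := congrArg (fun l => l.getD (n - 1 - i) false) heq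
    simp only at this
    rw [getD_range_map _ _ _ (by omega), getD_range_map _ _ _ (by omega)] at this
    have e : n - 1 - (n - 1 - i) = i := by omega
    rw [e] at this
    simpa using this

open Classical in
lemma g_eq (g : Good ℓ A B) (n : ℕ) (S : Finset (Fin (n + 1 - ℓ) × Bool)) :
    ((words n).filter (fun w => Oset ℓ A B n w = S)).card =
      ((words n).filter (fun w => Oset ℓ A B n w = S.map (flipE _).toEmbedding)).card := by
  have key : ∀ S : Finset (Fin (n + 1 - ℓ) × Bool),
      ((words n).filter (fun w => S ⊆ Oset ℓ A B n w)).card =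
      ((words n).filter (fun w => S.map (flipE _).toEmbedding ⊆ Oset ℓ A B n w)).card := by
    intro S
    apply le_antisymm (f_le g n S)
    have := f_le g n (S.map (flipE _).toEmbedding)
    have e : (S.map (flipE _).toEmbedding).map (flipE _).toEmbedding = S := by
      ext k
      simp only [Finset.mem_map, Equiv.coe_toEmbedding]
      constructor
      · rintro ⟨_, ⟨k, hk, rfl⟩, rfl⟩; rwa [flipE_flipE]
      · intro hk; exact ⟨_, ⟨k, hk, rfl⟩, flipE_flipE k⟩
    rwa [e] at this
  have := incl_excl (words n) (Oset ℓ A B n) (flipE _) (by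
    intro S
    convert key S) S
  convert this

/-- start of block `j` -/
def st (I : List ℕ) (M : List (List Bool)) (j : ℕ) : ℕ :=
  (I.take (j + 1)).sum + ((M.map List.length).take j).sum

/-- total length -/
def tot (I : List ℕ) (M : List (List Bool)) : ℕ := I.sum + (M.map List.length).sum

lemma st_zero (i : ℕ) (I : List ℕ) (M : List (List Bool)) : st (i :: I) M 0 = i := by simp [st]

lemma st_succ (i : ℕ) (I : List ℕ) (E : List Bool) (M : List (List Bool)) (j : ℕ) :
    st (i :: I) (E :: M) (j + 1) = i + E.length + st I M j := by
  simp [st]; omega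

lemma tot_cons (i : ℕ) (I : List ℕ) (E : List Bool) (M : List (List Bool)) :
    tot (i :: I) (E :: M) = i + E.length + tot I M := by
  simp [tot]; omega

lemma st_tot : ∀ (M : List (List Bool)) (I : List ℕ) (j : ℕ), I.length = M.length + 1 →
    j < M.length → st I M j + (M.getD j []).length ≤ tot I M := by
  intro M
  induction M with
  | nil => intro I j _ h; simp at h
  | cons E M ih =>
    intro I j hI hj
    cases I with
    | nil => simp at hI
    | cons i I =>
      rw [tot_cons]
      cases j with
      | zero => rw [st_zero]; simp
      | succ j =>
        have := ih I j (by simpa using hI) (by simpa using hj)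
        rw [st_succ]; simp at this ⊢; omega

lemma st_lt : ∀ (M : List (List Bool)) (I : List ℕ) (j j' : ℕ), I.length = M.length + 1 →
    j < j' → j' < M.length → st I M j + (M.getD j []).length ≤ st I M j' := by
  intro M
  induction M with
  | nil => intro I j j' _ _ h; simp at h
  | cons E M ih =>
    intro I j j' hI hjj hj
    cases I with
    | nil => simp at hI
    | cons i I =>
      cases j' with
      | zero => omega
      | succ j' =>
        cases j with
        | zero => rw [st_zero, st_succ]; simp
        | succ j =>
          have := ih I j j' (by simpa using hI) (by omega) (by simpa using hj)
          rw [st_succ, st_succ]; simp at this ⊢; omega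

lemma seg : ∀ (M Xs : List (List Bool)), Xs.length = M.length + 1 →
    (interleave Xs M).length = tot (Xs.map List.length) M ∧
    (∀ j, j < M.length → occ (M.getD j []) (interleave Xs M) (st (Xs.map List.length) M j)) ∧
    ∀ X ∈ Xs, ∃ t, occ X (interleave Xs M) t ∧ ∀ j, j < M.length →
      t + X.length ≤ st (Xs.map List.length) M j ∨
      st (Xs.map List.length) M j + (M.getD j []).length ≤ t := by
  intro M
  induction M with
  | nil =>
    intro Xs h
    obtain ⟨X, rfl⟩ := List.length_eq_one_iff.1 (by simpa using h)
    refine ⟨by simp [interleave, tot], by simp, ?_⟩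
    intro X' hX'
    rw [List.mem_singleton] at hX'
    subst hX'
    exact ⟨0, occ_self _, by simp⟩
  | cons E M ih =>
    intro Xs h
    cases Xs with
    | nil => simp at h
    | cons X Xs =>
      obtain ⟨h1, h2, h3⟩ := ih Xs (by simpa using h)
      have hi : interleave (X :: Xs) (E :: M) = (X ++ E) ++ interleave Xs M := rfl
      rw [hi, List.map_cons]
      refine ⟨?_, ?_, ?_⟩
      · rw [tot_cons, List.length_append, h1]; simp
      · intro j hj
        cases j with
        | zero =>
          rw [st_zero]
          exact occ_app_l _ (occ_app_r X (occ_self E))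
        | succ j =>
          rw [st_succ]
          have := occ_app_r (X ++ E) (h2 j (by simpa using hj))
          simpa using this
      · intro Z hZ
        rw [List.mem_cons] at hZ
        rcases hZ with rfl | hZ
        · refine ⟨0, occ_app_l _ (occ_app_l _ (occ_self _)), ?_⟩
          intro j hj
          left
          cases j with
          | zero => rw [st_zero]; omega
          | succ j => rw [st_succ]; omega
        · obtain ⟨t, ht1, ht2⟩ := h3 Z hZ
          refine ⟨_, occ_app_r (X ++ E) ht1, ?_⟩
          intro j hj
          cases j with
          | zero => right; rw [st_zero]; simp
          | succ j =>
            rw [st_succ]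
            have := ht2 j (by simpa using hj)
            simp at this ⊢; omega

lemma seg_conv : ∀ (M : List (List Bool)) (I : List ℕ) (Y : List Bool), I.length = M.length + 1 →
    Y.length = tot I M → (∀ j, j < M.length → occ (M.getD j []) Y (st I M j)) →
    ∃ Xs : List (List Bool), Xs.map List.length = I ∧ Y = interleave Xs M := by
  intro M
  induction M with
  | nil =>
    intro I Y h h2 _
    obtain ⟨i, rfl⟩ := List.length_eq_one_iff.1 (by simpa using h)
    exact ⟨[Y], by simpa [tot] using h2, rfl⟩
  | cons E M ih =>
    intro I Y h h2 h3
    cases I with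
    | nil => simp at h
    | cons i I =>
      rw [tot_cons] at h2
      have h30 := h3 0 (by simp)
      rw [st_zero] at h30
      simp only [List.getD_cons_zero] at h30
      obtain ⟨Xs, hXs, hY⟩ := ih I (Y.drop (i + E.length)) (by simpa using h) (by simp; omega) (by
        intro j hj
        have := h3 (j + 1) (by simpa using hj)
        rw [st_succ] at this
        simp only [List.getD_cons_succ] at this
        refine ⟨by have := this.1; rw [List.length_drop]; omega, ?_⟩
        intro x hx
        rw [getD_drop', ← this.2 x hx]
        congr 1; omega)
      refine ⟨Y.take i :: Xs, by simp [hXs]; omega, ?_⟩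
      simp only [interleave]
      rw [← hY]
      have hE := ((occ_iff _ _ _).1 h30).2
      conv_rhs => rw [← hE]
      rw [hE, ← List.drop_drop]
      conv_lhs => rw [← List.take_append_drop i Y, ← List.take_append_drop E.length (Y.drop i), hE]
      simp

/-- target occurrence predicate -/
def Tp (A B : List Bool) (I : List ℕ) (M : List (List Bool)) (p : ℕ) (a : Bool) : Prop :=
  ∃ j, j < M.length ∧ st I M j ≤ p ∧ occ (wd A B a) (M.getD j []) (p - st I M j)

lemma sum_getD (f : List Bool → ℕ) (M : List (List Bool)) :
    ∑ j ∈ Finset.range M.length, f (M.getD j []) = (M.map f).sum := by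
  induction M with
  | nil => simp
  | cons E M ih => simp [Finset.sum_range_succ'] at ih ⊢; omega

open Classical in
lemma Tp_count (g : Good ℓ A B) (I : List ℕ) (M : List (List Bool)) (a : Bool)
    (hI : I.length = M.length + 1) :
    ((Finset.range (tot I M + 1)).filter (fun p => Tp A B I M p a)).card =
      (M.map (countOcc (wd A B a))).sum := by
  rw [← sum_getD]
  have e : (Finset.range (tot I M + 1)).filter (fun p => Tp A B I M p a) =
      (Finset.range M.length).biUnion (fun j =>
        ((Finset.range ((M.getD j []).length + 1)).filter
          (fun i => occ (wd A B a) (M.getD j []) i)).image (fun i => st I M j + i)) := by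
    ext p
    simp only [Finset.mem_filter, Finset.mem_biUnion, Finset.mem_image, Finset.mem_range]
    constructor
    · rintro ⟨_, j, hj, h1, h2⟩
      exact ⟨j, hj, p - st I M j, ⟨by have := h2.1; omega, h2⟩, by omega⟩
    · rintro ⟨j, hj, i, ⟨h1, h2⟩, rfl⟩
      have := st_tot M I j hI hj
      exact ⟨by omega, j, hj, by omega, by simpa using h2⟩
  rw [e, Finset.card_biUnion]
  · apply Finset.sum_congr rfl
    intro j _
    rw [Finset.card_image_of_injective _ (add_right_injective _), countOcc_eq]
  · have aux : ∀ j j', j < j' → j' < M.length → ∀ i i', occ (wd A B a) (M.getD j []) i →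
        occ (wd A B a) (M.getD j' []) i' → st I M j + i ≠ st I M j' + i' := by
      intro j j' h1 h2 i i' h3 h4 h5
      have := st_lt M I j j' hI h1 h2
      have h6 := h3.1
      rw [g.len] at h6
      have := g.pos
      omega
    intro j hj j' hj' hne
    change Disjoint _ _
    rw [Finset.disjoint_left]
    intro p hp hp'
    simp only [Finset.mem_coe, Finset.mem_filter, Finset.mem_image, Finset.mem_range] at *
    obtain ⟨i, ⟨_, h1⟩, h2⟩ := hp
    obtain ⟨i', ⟨_, h1'⟩, h2'⟩ := hp'
    rcases lt_or_gt_of_ne hne with h | h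
    · exact aux j j' h hj' i i' h1 h1' (by omega)
    · exact aux j' j h hj i' i h1' h1 (by omega)

lemma decomp_iff (g : Good ℓ A B) (I : List ℕ) (M : List (List Bool)) (Y : List Bool)
    (hI : I.length = M.length + 1) (hM : ∀ E ∈ M, isOverlap A B E) :
    (∃ Xs, isDecomp A B Y Xs M ∧ Xs.map List.length = I) ↔
      (Y.length = tot I M ∧ ∀ p a, occ (wd A B a) Y p ↔ Tp A B I M p a) := by
  classical
  constructor
  · rintro ⟨Xs, ⟨h1, rfl, h3, h4, h5, h6⟩, rfl⟩
    obtain ⟨s1, s2, -⟩ := seg M Xs h1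
    refine ⟨s1, ?_⟩
    intro p a
    have hc : countOcc (wd A B a) (interleave Xs M) = (M.map (countOcc (wd A B a))).sum := by
      cases a
      · exact h6
      · exact h5
    rw [← Tp_count g _ M a hI, countOcc_eq, s1] at hc
    have hsub : (Finset.range (tot (Xs.map List.length) M + 1)).filter
        (fun p => Tp A B (Xs.map List.length) M p a) ⊆
        (Finset.range (tot (Xs.map List.length) M + 1)).filter
        (fun p => occ (wd A B a) (interleave Xs M) p) := by
      intro p hp
      rw [Finset.mem_filter] at hp ⊢
      obtain ⟨hp1, j, hj, q1, q2⟩ := hp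
      refine ⟨hp1, ?_⟩
      have := occ_trans q2 (s2 j hj)
      convert this using 1; omega
    have heq := Finset.eq_of_subset_of_card_le hsub hc.le
    have := congrArg (fun s => p ∈ s) heq
    simp only [Finset.mem_filter, Finset.mem_range, eq_iff_iff] at this
    constructor
    · intro h
      exact (this.2 ⟨by have := h.1; omega, h⟩).2
    · intro h
      refine (this.1 ⟨?_, h⟩).2
      obtain ⟨j, hj, q1, q2⟩ := h
      have := st_tot M _ j hI hj
      have := q2.1
      omega
  · rintro ⟨h1, h2⟩
    have hocc : ∀ j, j < M.length → occ (M.getD j []) Y (st I M j) := by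
      intro j hj
      refine ⟨by rw [h1]; exact st_tot M I j hI hj, ?_⟩
      intro x hx
      have hmem : M.getD j [] ∈ M := by
        rw [List.getD_eq_getElem _ _ hj]; exact List.getElem_mem hj
      obtain ⟨p, a, k1, k2, k3⟩ := overlap_cover g (hM _ hmem) x hx
      have k4 : occ (wd A B a) Y (st I M j + p) :=
        (h2 _ _).2 ⟨j, hj, by omega, by simpa using k1⟩
      have e1 := k4.2 (x - p) (by rw [g.len]; omega)
      have e2 := k1.2 (x - p) (by rw [g.len]; omega)
      rw [← e2] at e1
      convert e1 using 2 <;> omega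
    obtain ⟨Xs, rfl, rfl⟩ := seg_conv M I Y hI h1 hocc
    have hX : Xs.length = M.length + 1 := by simpa using hI
    obtain ⟨s1, s2, s3⟩ := seg M Xs hX
    have hno : ∀ a, ∀ X ∈ Xs, countOcc (wd A B a) X = 0 := by
      intro a X hXm
      rw [countOcc_zero]
      intro p hp
      obtain ⟨t, ht, ht2⟩ := s3 X hXm
      obtain ⟨j, hj, q1, q2⟩ := (h2 _ _).1 (occ_trans hp ht)
      have r1 := ht2 j hj
      have r2 := q2.1
      have r3 := hp.1
      rw [g.len] at r2 r3
      have := g.pos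
      omega
    have hcnt : ∀ a, countOcc (wd A B a) (interleave Xs M) =
        (M.map (countOcc (wd A B a))).sum := by
      intro a
      rw [← Tp_count g _ M a hI, countOcc_eq, s1]
      congr 1
      ext p
      simp only [Finset.mem_filter, h2]
    exact ⟨Xs, ⟨hX, rfl, hM, fun X h => ⟨hno true X h, hno false X h⟩, hcnt true, hcnt false⟩, rfl⟩

open Classical in
lemma patCount_eq (g : Good ℓ A B) (I : List ℕ) (M : List (List Bool)) (n : ℕ)
    (hn : n = tot I M) (hI : I.length = M.length + 1) (hM : ∀ E ∈ M, isOverlap A B E) :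
    patCount A B M I = ((words n).filter (fun w => Oset ℓ A B n w =
      Finset.univ.filter (fun k => Tp A B I M k.1 k.2))).card := by
  subst hn
  unfold patCount
  rw [← Set.ncard_coe_finset]
  congr 1
  ext Y
  rw [Set.mem_ofPred_eq, decomp_iff g I M Y hI hM, Finset.mem_coe, Finset.mem_filter, mem_words]
  refine and_congr_right ?_
  intro hY
  rw [Finset.ext_iff]
  constructor
  · intro h k
    rw [mem_Oset, h]; simp
  · intro h p a
    have hb : p + ℓ ≤ tot I M → (occ (wd A B a) Y p ↔ Tp A B I M p a) := by
      intro hp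
      have := h (⟨p, by omega⟩, a)
      rw [mem_Oset] at this
      simpa using this
    constructor
    · intro ho
      refine (hb ?_).1 ho
      have := ho.1
      rw [g.len] at this; omega
    · intro ho
      refine (hb ?_).2 ho
      obtain ⟨j, hj, q1, q2⟩ := ho
      have := st_tot M I j hI hj
      have := q2.1
      rw [g.len] at this; omega

lemma st_flip (I : List ℕ) (M M' : List (List Bool))
    (hI : I.length = M.length + 1)
    (hl : M'.map List.length = (M.map List.length).reverse) (j : ℕ) (hj : j < M.length) :
    st I.reverse M' (M.length - 1 - j) + st I M j + (M.getD j []).length = tot I M := by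
  unfold st tot
  rw [hl, List.take_reverse, List.take_reverse, List.sum_reverse, List.sum_reverse]
  have e1 : I.length - (M.length - 1 - j + 1) = j + 1 := by omega
  have e2 : (M.map List.length).length - (M.length - 1 - j) = j + 1 := by simp; omega
  rw [e1, e2]
  have e3 := List.sum_take_add_sum_drop I (j + 1)
  have e4 := List.sum_take_add_sum_drop (M.map List.length) (j + 1)
  have e5 : ((M.map List.length).take (j + 1)).sum =
      ((M.map List.length).take j).sum + (M.getD j []).length := by
    rw [List.sum_take_succ _ _ (by simpa using hj)]
    rw [List.getD_eq_getElem _ _ hj]; simp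
  omega

lemma main_good (g : Good ℓ A B) (M M' : List (List Bool)) (I : List ℕ)
    (hM : patternFlip A B M M') (hI : I.length = M.length + 1) :
    patCount A B M I = patCount A B M' I.reverse := by
  classical
  obtain ⟨hlen, hf⟩ := hM
  have hf' : ∀ j, j < M.length → overlapFlip A B (M.getD j []) (M'.getD (M.length - 1 - j) []) := by
    intro j hj
    have := hf (M.length - 1 - j) (by omega)
    convert this using 1
    rw [List.getD_eq_getElem _ _ hj, List.getD_eq_getElem _ _ (by simp; omega), List.getElem_reverse]
    congr 1; omega
  have hO : ∀ E ∈ M, isOverlap A B E := by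
    intro E hE
    obtain ⟨j, hj, rfl⟩ := List.mem_iff_getElem.1 hE
    have := (flip_overlap g (hf' j hj)).1
    rwa [List.getD_eq_getElem _ _ hj] at this
  have hO' : ∀ E ∈ M', isOverlap A B E := by
    intro E hE
    obtain ⟨j, hj, rfl⟩ := List.mem_iff_getElem.1 hE
    have := (flip_overlap g (hf j (by omega))).2.1
    rwa [List.getD_eq_getElem _ _ hj] at this
  have hl : M'.map List.length = (M.map List.length).reverse := by
    apply List.ext_getElem
    · simp [hlen]
    · intro j h1 h2
      have hj : j < M'.length := by simpa using h1
      have := (flip_overlap g (hf j (by omega))).2.2.2.1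
      rw [List.getD_eq_getElem _ _ hj, List.getD_eq_getElem _ _ (by simp; omega),
        List.getElem_reverse] at this
      simp [this]
  have htot : tot I M = tot I.reverse M' := by
    unfold tot; rw [hl, List.sum_reverse, List.sum_reverse]
  rw [patCount_eq g I M (tot I M) rfl hI hO,
    patCount_eq g I.reverse M' (tot I M) htot (by simp [hI, hlen]) hO', g_eq g]
  congr 3
  ext w
  congr! 1
  -- per-block equivalence
  have hblock : ∀ j, j < M.length → ∀ p a, p + ℓ ≤ tot I M →
      ((st I M j ≤ p ∧ occ (wd A B a) (M.getD j []) (p - st I M j)) ↔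
        (st I.reverse M' (M.length - 1 - j) ≤ tot I M - ℓ - p ∧
          occ (wd A B !a) (M'.getD (M.length - 1 - j) [])
            (tot I M - ℓ - p - st I.reverse M' (M.length - 1 - j)))) := by
    intro j hj p a hp
    obtain ⟨-, -, f1, f2, f3⟩ := flip_overlap g (hf' j hj)
    have hs := st_flip I M M' hI hl j hj
    constructor
    · rintro ⟨q1, q2⟩
      have q3 := q2.1
      rw [g.len] at q3
      refine ⟨by omega, ?_⟩
      have := (f3 _ _ q3).1 q2
      convert this using 1; omega
    · rintro ⟨q1, q2⟩
      have q3 := q2.1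
      rw [g.len] at q3
      refine ⟨by omega, ?_⟩
      rw [f3 _ _ (by omega)]
      convert q2 using 1; omega
  have hT : ∀ p a, p + ℓ ≤ tot I M →
      (Tp A B I M p a ↔ Tp A B I.reverse M' (tot I M - ℓ - p) !a) := by
    intro p a hp
    constructor
    · rintro ⟨j, hj, q⟩
      exact ⟨M.length - 1 - j, by omega, (hblock j hj p a hp).1 q⟩
    · rintro ⟨j, hj, q⟩
      refine ⟨M.length - 1 - j, by omega, (hblock _ (by omega) p a hp).2 ?_⟩
      have : M.length - 1 - (M.length - 1 - j) = j := by omega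
      rw [this]; exact q
  ext k
  simp only [Finset.mem_map, Finset.mem_filter, Finset.mem_univ, true_and, Equiv.coe_toEmbedding]
  have hfk : ∀ k, Tp A B I M (k : Fin (tot I M + 1 - ℓ) × Bool).1 k.2 ↔
      Tp A B I.reverse M' (flipE _ k).1 (flipE _ k).2 := by
    intro k
    have hk := k.1.2
    rw [flipE_fst, flipE_snd, hT _ _ (by omega)]
    have : tot I M + 1 - ℓ - 1 - k.1 = tot I M - ℓ - k.1 := by omega
    rw [this]
  constructor
  · rintro ⟨k, hk, rfl⟩
    exact (hfk k).1 hk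
  · intro hk
    refine ⟨flipE _ k, ?_, flipE_flipE k⟩
    rw [hfk, flipE_flipE]; exact hk

lemma patCount_zero (M : List (List Bool)) (I : List ℕ)
    (h : I.length ≠ M.length + 1) : patCount A B M I = 0 := by
  unfold patCount
  convert Set.ncard_empty (List Bool)
  rw [Set.eq_empty_iff_forall_notMem]
  rintro Y ⟨Xs, hd, rfl⟩
  exact h (by simpa using hd.1)

lemma patCount_nil (M : List (List Bool)) (I : List ℕ) (hA : A = []) : patCount A B M I = 0 := by
  subst hA
  unfold patCount
  convert Set.ncard_empty (List Bool)
  rw [Set.eq_empty_iff_forall_notMem]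
  rintro Y ⟨Xs, hd, rfl⟩
  cases Xs with
  | nil => have := hd.1; simp at this
  | cons X Xs =>
    have := (hd.2.2.2.1 X (by simp)).1
    rw [countOcc_zero] at this
    exact this 0 ⟨by simp, by simp⟩

end

/-- gap-count symmetry: for `A`, `B` of length `ℓ` with
`Cor(A,A) = Cor(B,B)`, if `M' = φ(M) = (φ(E_k),…,φ(E₁))` is the flipped
pattern, then `L^M(I) = L^{φ(M)}(I')` where `I'` is the reversed gap tuple. -/
theorem pattern_count_symm (ℓ : ℕ) (A B : List Bool)
    (hA : A.length = ℓ) (hB : B.length = ℓ) (hcor : corSet A A = corSet B B)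
    (M M' : List (List Bool)) (I : List ℕ) (hM : patternFlip A B M M') :
    patCount A B M I = patCount A B M' I.reverse := by
  by_cases hI : I.length = M.length + 1
  · rcases Nat.eq_zero_or_pos ℓ with h0 | h0
    · have : A = [] := List.length_eq_zero_iff.1 (by omega)
      rw [patCount_nil _ _ this, patCount_nil _ _ this]
    · exact main_good ⟨hA, hB, hcor, h0⟩ M M' I hM hI
  · rw [patCount_zero _ _ hI, patCount_zero]
    rw [List.length_reverse, hM.1]; exact hI
end
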